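/- arXiv:0909.0982 — 2 statements merged into one kernel-verified Lean document; each statement's English description precedes it below -/
import Mathlib

section
/- Let X₁ and X₂ be zero-dimensional Hausdorff spaces, and for i = 1, 2 let fᵢ : Xᵢ → Yᵢ be a topological embedding with dense image into a zero-dimensional locally compact Hausdorff space Yᵢ. Set Aᵢ = {fᵢ⁻¹(G) : G clopen in Yᵢ} and Iᵢ = {fᵢ⁻¹(G) : G compact clopen in Yᵢ}. Let f : X₁ → X₂ be an arbitrary function. Then there exists a continuous map g : Y₁ → Y₂ with g ∘ f₁ = f₂ ∘ f if and only if f satisfies the two conditions: (ZEQ1) for every G ∈ A₂, f⁻¹(G) ∈ A₁; and (ZEQ2) for every F ∈ I₁ there exists G ∈ I₂ with f(F) ⊆ G. -/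
open Topology TopologicalSpace Set

/-- In a zero-dimensional locally compact space, every compact set is contained in a compact
clopen set. -/
theorem exists_isClopen_isCompact_superset {Y : Type*} [TopologicalSpace Y] [T2Space Y]
    [LocallyCompactSpace Y] (hY : IsTopologicalBasis {s : Set Y | IsClopen s})
    {K : Set Y} (hK : IsCompact K) :
    ∃ G : Set Y, IsClopen G ∧ IsCompact G ∧ K ⊆ G := by
  refine hK.induction_on ⟨∅, isClopen_empty, isCompact_empty, subset_rfl⟩ ?_ ?_ ?_
  · rintro s t hst ⟨G, hG, hGc, htG⟩
    exact ⟨G, hG, hGc, hst.trans htG⟩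
  · rintro s t ⟨G, hG, hGc, hsG⟩ ⟨H, hH, hHc, htH⟩
    exact ⟨G ∪ H, hG.union hH, hGc.union hHc, union_subset_union hsG htH⟩
  · intro x _
    obtain ⟨L, hL, hxL⟩ := exists_compact_mem_nhds x
    obtain ⟨G, hG : IsClopen G, hxG, hGL⟩ := hY.mem_nhds_iff.1 hxL
    exact ⟨G, mem_nhdsWithin_of_mem_nhds (hG.isOpen.mem_nhds hxG), G, hG,
      hL.of_isClosed_subset hG.isClosed hGL, subset_rfl⟩

/-- Let `i : X → Y` have dense range, and let `h` map `X` to a zero-dimensional space `Z`. If `h`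
maps some trace of a neighbourhood of `y` into a compact set and preimages of clopen sets under `h`
are traces of clopen sets of `Y`, then `h` has a limit at `y`. -/
theorem exists_tendsto_comap_nhds_of_clopen {X Y Z : Type*} [TopologicalSpace Y]
    [TopologicalSpace Z] (hZ : IsTopologicalBasis {s : Set Z | IsClopen s})
    {i : X → Y} (hi : DenseRange i) {h : X → Z}
    (hh : ∀ U : Set Z, IsClopen U → ∃ V : Set Y, IsClopen V ∧ h ⁻¹' U = i ⁻¹' V)
    {y : Y} {K : Set Y} (hK : K ∈ 𝓝 y) {C : Set Z} (hC : IsCompact C)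
    (hKC : i ⁻¹' K ⊆ h ⁻¹' C) :
    ∃ z, Filter.Tendsto h (Filter.comap i (𝓝 y)) (𝓝 z) := by
  have : (Filter.comap i (𝓝 y)).NeBot :=
    Filter.comap_neBot fun s hs => hi.mem_nhds hs
  have hle : Filter.map h (Filter.comap i (𝓝 y)) ≤ Filter.principal C :=
    Filter.le_principal_iff.2 <| Filter.mem_map.2 <|
      Filter.mem_of_superset (Filter.preimage_mem_comap hK) hKC
  obtain ⟨z, _, hz⟩ := hC hle
  refine ⟨z, hZ.nhds_hasBasis.tendsto_right_iff.2 ?_⟩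
  rintro U ⟨hU, hzU⟩
  obtain ⟨V, hV, hUV⟩ := hh U hU
  by_cases hyV : y ∈ V
  · have := Filter.preimage_mem_comap (m := i) (hV.isOpen.mem_nhds hyV)
    rwa [← hUV] at this
  · have hmem := Filter.preimage_mem_comap (m := i) (hV.compl.isOpen.mem_nhds hyV)
    rw [preimage_compl, ← hUV, ← preimage_compl] at hmem
    obtain ⟨w, hw, hw'⟩ := clusterPt_iff_nonempty.1 hz (hU.isOpen.mem_nhds hzU) hmem
    exact absurd hw hw'

theorem stmt7 {X₁ X₂ Y₁ Y₂ : Type*}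
    [TopologicalSpace X₁] [T2Space X₁]
    (hX₁ : IsTopologicalBasis {s : Set X₁ | IsClopen s})
    [TopologicalSpace X₂] [T2Space X₂]
    (hX₂ : IsTopologicalBasis {s : Set X₂ | IsClopen s})
    [TopologicalSpace Y₁] [T2Space Y₁] [LocallyCompactSpace Y₁]
    (hY₁ : IsTopologicalBasis {s : Set Y₁ | IsClopen s})
    [TopologicalSpace Y₂] [T2Space Y₂] [LocallyCompactSpace Y₂]
    (hY₂ : IsTopologicalBasis {s : Set Y₂ | IsClopen s})
    (f₁ : X₁ → Y₁) (hf₁ : IsEmbedding f₁) (hd₁ : DenseRange f₁)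
    (f₂ : X₂ → Y₂) (hf₂ : IsEmbedding f₂) (hd₂ : DenseRange f₂)
    (A₁ I₁ : Set (Set X₁)) (A₂ I₂ : Set (Set X₂))
    (hA₁ : A₁ = {S : Set X₁ | ∃ G : Set Y₁, IsClopen G ∧ S = f₁ ⁻¹' G})
    (hI₁ : I₁ = {S : Set X₁ | ∃ G : Set Y₁, IsClopen G ∧ IsCompact G ∧ S = f₁ ⁻¹' G})
    (hA₂ : A₂ = {S : Set X₂ | ∃ G : Set Y₂, IsClopen G ∧ S = f₂ ⁻¹' G})
    (hI₂ : I₂ = {S : Set X₂ | ∃ G : Set Y₂, IsClopen G ∧ IsCompact G ∧ S = f₂ ⁻¹' G})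
    (f : X₁ → X₂)
    :
    (∃ g : Y₁ → Y₂, Continuous g ∧ ∀ x : X₁, g (f₁ x) = f₂ (f x)) ↔
      ((∀ G ∈ A₂, f ⁻¹' G ∈ A₁) ∧ (∀ F ∈ I₁, ∃ G ∈ I₂, f '' F ⊆ G)) := by
  subst hA₁ hI₁ hA₂ hI₂
  constructor
  · rintro ⟨g, hg, hgf⟩
    constructor
    · rintro _ ⟨G, hG, rfl⟩
      refine ⟨g ⁻¹' G, hG.preimage hg, ?_⟩
      ext x
      simp [hgf]
    · rintro _ ⟨F, _, hFc, rfl⟩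
      obtain ⟨G, hG, hGc, hFG⟩ := exists_isClopen_isCompact_superset hY₂ (hFc.image hg)
      refine ⟨_, ⟨G, hG, hGc, rfl⟩, ?_⟩
      rintro _ ⟨x, hx, rfl⟩
      rw [mem_preimage, ← hgf]
      exact hFG (mem_image_of_mem g hx)
  · rintro ⟨hA, hI⟩
    have hi : IsDenseInducing f₁ := ⟨hf₁.isInducing, hd₁⟩
    have hclopen : ∀ U : Set Y₂, IsClopen U →
        ∃ V : Set Y₁, IsClopen V ∧ (f₂ ∘ f) ⁻¹' U = f₁ ⁻¹' V :=
      fun U hU => hA _ ⟨U, hU, rfl⟩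
    have hcont : Continuous (f₂ ∘ f) := by
      refine hY₂.continuous_iff.2 fun U hU => ?_
      obtain ⟨V, hV, hUV⟩ := hclopen U hU
      rw [hUV]
      exact hV.isOpen.preimage hf₁.continuous
    refine ⟨hi.extend (f₂ ∘ f), hi.continuous_extend fun y => ?_,
      fun x => hi.extend_eq hcont x⟩
    obtain ⟨K, hK, hKc, hyK⟩ :=
      exists_isClopen_isCompact_superset hY₁ (isCompact_singleton (x := y))
    obtain ⟨_, ⟨C, _, hCc, rfl⟩, hKC⟩ := hI _ ⟨K, hK, hKc, rfl⟩
    exact exists_tendsto_comap_nhds_of_clopen hY₂ hd₁ hclopen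
      (hK.isOpen.mem_nhds (hyK rfl)) hCc
      (image_subset_iff.1 hKC : f₁ ⁻¹' K ⊆ f ⁻¹' (f₂ ⁻¹' C))
end

section
/- Let X₁ and X₂ be zero-dimensional Hausdorff spaces, and for i = 1, 2 let fᵢ : Xᵢ → Yᵢ be a topological embedding with dense image into a zero-dimensional locally compact Hausdorff space Yᵢ; set Aᵢ = {fᵢ⁻¹(G) : G clopen in Yᵢ} and Iᵢ = {fᵢ⁻¹(G) : G compact clopen in Yᵢ}. Let f : X₁ → X₂ satisfy (ZEQ1): for every G ∈ A₂, f⁻¹(G) ∈ A₁, and (ZEQ2): for every F ∈ I₁ there exists G ∈ I₂ with f(F) ⊆ G, and let g : Y₁ → Y₂ be a continuous map with g ∘ f₁ = f₂ ∘ f. Then g is an injective closed map if and only if {f⁻¹(G) : G ∈ I₂} = I₁. -/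
open Topology TopologicalSpace Set

theorem IsCompact.exists_isClopen_isCompact_between {Y : Type*} [TopologicalSpace Y] [T2Space Y]
    [LocallyCompactSpace Y] (hY : IsTopologicalBasis {s : Set Y | IsClopen s})
    {K U : Set Y} (hK : IsCompact K) (hU : IsOpen U) (hKU : K ⊆ U) :
    ∃ G : Set Y, IsClopen G ∧ IsCompact G ∧ K ⊆ G ∧ G ⊆ U := by
  obtain ⟨L, hL, hKL, hLU⟩ := exists_compact_between hK hU hKU
  obtain ⟨G, hG, hKG, hGL⟩ : ∃ G : Set Y, IsClopen G ∧ K ⊆ G ∧ G ⊆ L := by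
    refine hK.induction_on (p := fun s => ∃ G : Set Y, IsClopen G ∧ s ⊆ G ∧ G ⊆ L) ?_ ?_ ?_ ?_
    · exact ⟨∅, isClopen_empty, Subset.rfl, empty_subset _⟩
    · rintro s t hst ⟨G, hG, htG, hGL⟩
      exact ⟨G, hG, hst.trans htG, hGL⟩
    · rintro s t ⟨G, hG, hsG, hGL⟩ ⟨H, hH, htH, hHL⟩
      exact ⟨G ∪ H, hG.union hH, union_subset_union hsG htH, union_subset hGL hHL⟩
    · intro x hx
      obtain ⟨G, hG, hxG, hGL⟩ := hY.exists_subset_of_mem_open (hKL hx) isOpen_interior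
      exact ⟨G, mem_nhdsWithin_of_mem_nhds (IsOpen.mem_nhds (IsClopen.isOpen hG) hxG), G, hG,
        Subset.rfl, hGL.trans interior_subset⟩
  exact ⟨G, hG, hL.of_isClosed_subset hG.isClosed hGL, hKG, hGL.trans hLU⟩

theorem DenseRange.preimage_injOn_isClopen {X Y : Type*} [TopologicalSpace Y] {e : X → Y}
    (he : DenseRange e) : InjOn (fun s : Set Y => e ⁻¹' s) {s | IsClopen s} := by
  intro G hG H hH h
  have key : ∀ {A : Set Y}, IsClopen A → closure (e '' (e ⁻¹' A)) = A := fun {A} hA => by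
    rw [image_preimage_eq_inter_range]
    refine Subset.antisymm (closure_minimal inter_subset_left hA.isClosed) ?_
    exact Dense.open_subset_closure_inter he hA.isOpen
  rw [← key hG, ← key hH]
  exact congrArg (fun s => closure (e '' s)) h

theorem stmt16 {X₁ X₂ Y₁ Y₂ : Type*}
    [TopologicalSpace X₁] [T2Space X₁]
    (hX₁ : IsTopologicalBasis {s : Set X₁ | IsClopen s})
    [TopologicalSpace X₂] [T2Space X₂]
    (hX₂ : IsTopologicalBasis {s : Set X₂ | IsClopen s})
    [TopologicalSpace Y₁] [T2Space Y₁] [LocallyCompactSpace Y₁]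
    (hY₁ : IsTopologicalBasis {s : Set Y₁ | IsClopen s})
    [TopologicalSpace Y₂] [T2Space Y₂] [LocallyCompactSpace Y₂]
    (hY₂ : IsTopologicalBasis {s : Set Y₂ | IsClopen s})
    (f₁ : X₁ → Y₁) (hf₁ : IsEmbedding f₁) (hd₁ : DenseRange f₁)
    (f₂ : X₂ → Y₂) (hf₂ : IsEmbedding f₂) (hd₂ : DenseRange f₂)
    (A₁ I₁ : Set (Set X₁)) (A₂ I₂ : Set (Set X₂))
    (hA₁ : A₁ = {S : Set X₁ | ∃ G : Set Y₁, IsClopen G ∧ S = f₁ ⁻¹' G})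
    (hI₁ : I₁ = {S : Set X₁ | ∃ G : Set Y₁, IsClopen G ∧ IsCompact G ∧ S = f₁ ⁻¹' G})
    (hA₂ : A₂ = {S : Set X₂ | ∃ G : Set Y₂, IsClopen G ∧ S = f₂ ⁻¹' G})
    (hI₂ : I₂ = {S : Set X₂ | ∃ G : Set Y₂, IsClopen G ∧ IsCompact G ∧ S = f₂ ⁻¹' G})
    (f : X₁ → X₂)
    (hZEQ1 : ∀ G ∈ A₂, f ⁻¹' G ∈ A₁)
    (hZEQ2 : ∀ F ∈ I₁, ∃ G ∈ I₂, f '' F ⊆ G)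
    (g : Y₁ → Y₂) (hg : Continuous g) (hcomm : ∀ x : X₁, g (f₁ x) = f₂ (f x))
    :
    (Function.Injective g ∧ IsClosedMap g) ↔ {T : Set X₁ | ∃ G ∈ I₂, T = f ⁻¹' G} = I₁ := by
  have hpre : ∀ G : Set Y₂, f ⁻¹' (f₂ ⁻¹' G) = f₁ ⁻¹' (g ⁻¹' G) := fun G => by
    ext x
    simp only [mem_preimage, hcomm]
  subst hI₁ hI₂
  constructor
  · rintro ⟨hinj, hcl⟩
    have hemb : IsClosedEmbedding g := .of_continuous_injective_isClosedMap hg hinj hcl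
    ext T
    constructor
    · rintro ⟨_, ⟨G, hG, hGc, rfl⟩, rfl⟩
      exact ⟨g ⁻¹' G, hG.preimage hg, hemb.isCompact_preimage hGc, hpre G⟩
    · rintro ⟨K, hK, hKc, rfl⟩
      obtain ⟨G, hG, hGc, hKG, hGK⟩ := (hKc.image hg).exists_isClopen_isCompact_between hY₂
        (hcl _ hK.compl.isClosed).isOpen_compl
        (disjoint_compl_right.image hinj.injOn (subset_univ K) (subset_univ Kᶜ)).subset_compl_right
      refine ⟨f₂ ⁻¹' G, ⟨G, hG, hGc, rfl⟩, ?_⟩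
      rw [hpre]
      congr 1
      refine Subset.antisymm (image_subset_iff.1 hKG) fun y hy => ?_
      by_contra hyK
      exact hGK hy (mem_image_of_mem g hyK)
  · intro h
    constructor
    · intro y y' hyy'
      by_contra hne
      obtain ⟨K, hK, hKc, hyK, hKy'⟩ :=
        (isCompact_singleton (x := y)).exists_isClopen_isCompact_between hY₁
          (isOpen_compl_singleton (x := y')) (by simpa using Ne.symm hne)
      obtain ⟨_, ⟨G, hG, -, rfl⟩, hT⟩ := h.superset ⟨K, hK, hKc, rfl⟩
      rw [hpre] at hT
      have hKG : K = g ⁻¹' G := hd₁.preimage_injOn_isClopen hK (hG.preimage hg) hT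
      have hy : y ∈ g ⁻¹' G := hKG ▸ hyK rfl
      have hy' : y' ∈ K := by
        rw [hKG, mem_preimage, ← hyy']
        exact hy
      exact hKy' hy' rfl
    · refine (isProperMap_iff_isCompact_preimage.2 ⟨hg, fun C hC => ?_⟩).isClosedMap
      obtain ⟨G, hG, hGc, hCG, -⟩ :=
        hC.exists_isClopen_isCompact_between hY₂ isOpen_univ (subset_univ C)
      obtain ⟨K, hK, hKc, hT⟩ := h.subset ⟨_, ⟨G, hG, hGc, rfl⟩, rfl⟩
      rw [hpre] at hT
      have hKG : g ⁻¹' G = K := hd₁.preimage_injOn_isClopen (hG.preimage hg) hK hT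
      exact hKc.of_isClosed_subset (hC.isClosed.preimage hg) (hKG ▸ preimage_mono hCG)
end
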